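/- Let K and L be quadratic number fields that are not isomorphic (equivalently, d_K ≠ d_L). Then the real number log|d_K| − log|d_L| + (π/2)·(r₁(L) − r₁(K)) is transcendental; in particular it is nonzero. (This is the key step of Theorem 1: it equals −2(ζ_K'(1/2)/ζ_K(1/2) − ζ_L'(1/2)/ζ_L(1/2)) whenever ζ_K(1/2)ζ_L(1/2) ≠ 0, so the two logarithmic derivatives at 1/2 differ.) -/

import Mathlib

open Polynomial in
/-- `bq d B z m k` is `(d ∂ + B)^m z^k`. -/
def bq {R : Type*} [CommRing R] (d B z : R) : ℕ → ℕ → R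
  | 0, k => z ^ k
  | m + 1, k => d * k * bq d B z m (k - 1) + B * bq d B z m k

theorem bq_map {R S : Type*} [CommRing R] [CommRing S] (f : R →+* S) (d B z : R) (m k : ℕ) :
    f (bq d B z m k) = bq (f d) (f B) (f z) m k := by
  induction m generalizing k with
  | zero => simp [bq]
  | succ m ih => simp [bq, ih]

theorem bq_norm_le (d B z : ℂ) (ρ : ℝ) (hρ : 1 ≤ ρ) (hz : ‖z‖ ≤ ρ) (m k : ℕ) :
    ‖bq d B z m k‖ ≤ (‖d‖ * k + ‖B‖) ^ m * ρ ^ k := by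
  induction m generalizing k with
  | zero => simpa [bq] using pow_le_pow_left₀ (norm_nonneg z) hz k
  | succ m ih =>
    have h1 : ‖bq d B z m (k - 1)‖ ≤ (‖d‖ * k + ‖B‖) ^ m * ρ ^ k := by
      refine (ih (k - 1)).trans ?_
      gcongr <;> omega
    have h2 := ih k
    have : ‖bq d B z (m + 1) k‖ ≤ ‖d‖ * k * ‖bq d B z m (k - 1)‖ + ‖B‖ * ‖bq d B z m k‖ := by
      rw [bq]
      refine (norm_add_le _ _).trans ?_
      simp
    refine this.trans ?_
    calc _ ≤ ‖d‖ * k * ((‖d‖ * k + ‖B‖) ^ m * ρ ^ k) + ‖B‖ * ((‖d‖ * k + ‖B‖) ^ m * ρ ^ k) := by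
            gcongr
      _ = _ := by ring

theorem bq_hasDerivAt (d B z : ℂ) (m k : ℕ) :
    HasDerivAt (fun z => bq d B z m k) (k * bq d B z m (k - 1)) z := by
  induction m generalizing k with
  | zero => simpa [bq] using hasDerivAt_pow k z
  | succ m ih =>
    simp only [bq]
    have := ((ih (k - 1)).const_mul (d * k)).add ((ih k).const_mul B)
    refine this.congr_deriv ?_
    ring

open Polynomial in
theorem bq_natDegree {R : Type*} [CommRing R] (d B : R) (m k : ℕ) :
    (bq (C d) (C B) X m k : R[X]).natDegree ≤ k := by
  induction m generalizing k with
  | zero => simpa [bq] using natDegree_X_pow_le (R := R) k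
  | succ m ih =>
    rw [bq]
    refine natDegree_add_le_of_degree_le ?_ ?_
    · rw [← C_eq_natCast, ← C_mul]
      refine (natDegree_C_mul_le _ _).trans ((ih (k - 1)).trans (by omega))
    · exact (natDegree_C_mul_le _ _).trans (ih k)

open Polynomial in
theorem bq_coeff {R : Type*} [CommRing R] (d B : R) (m k : ℕ) :
    (bq (C d) (C B) X m k : R[X]).coeff k = B ^ m := by
  induction m generalizing k with
  | zero => simp [bq]
  | succ m ih =>
    rw [bq]
    have h1 : (C d * (k : R[X]) * bq (C d) (C B) X m (k - 1) : R[X]).coeff k = 0 := by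
      rcases Nat.eq_zero_or_pos k with rfl | hk
      · simp
      · rw [← C_eq_natCast, ← C_mul, coeff_C_mul,
          coeff_eq_zero_of_natDegree_lt ((bq_natDegree d B m (k - 1)).trans_lt (by omega)), mul_zero]
    rw [coeff_add, h1, coeff_C_mul, ih]
    ring

/-- Division by zeros. -/
theorem exists_div_pow (f : ℂ → ℂ) (hf : Differentiable ℂ f) (s : ℂ) (T : ℕ)
    (h : (T : ℕ∞) ≤ analyticOrderAt f s) :
    ∃ g : ℂ → ℂ, Differentiable ℂ g ∧ ∀ z, f z = (z - s) ^ T * g z := by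
  induction T generalizing f with
  | zero => exact ⟨f, hf, by simp⟩
  | succ T ih =>
    have hs : f s = 0 := by
      apply apply_eq_zero_of_analyticOrderAt_ne_zero
      intro h0
      rw [h0] at h
      simp at h
    have hd : Differentiable ℂ (dslope f s) := by
      rw [← differentiableOn_univ] at hf ⊢
      exact (Complex.differentiableOn_dslope Filter.univ_mem).2 hf
    have hfe : f = fun z => (z - s) * dslope f s z := by
      funext z
      have := sub_smul_dslope f s z
      rw [hs, sub_zero, smul_eq_mul] at this
      exact this.symm
    have hord : (T : ℕ∞) ≤ analyticOrderAt (dslope f s) s := by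
      have h1 : analyticOrderAt f s
          = analyticOrderAt (fun z : ℂ => z - s) s + analyticOrderAt (dslope f s) s := by
        conv_lhs => rw [hfe]
        exact analyticOrderAt_mul (by fun_prop) (hd.analyticAt s)
      have h2 : analyticOrderAt (fun z : ℂ => z - s) s = 1 := by
        simp
      rw [h1, h2, add_comm] at h
      push_cast at h
      exact (ENat.add_le_add_iff_left ENat.one_ne_top).1 h
    obtain ⟨g, hg, hfg⟩ := ih _ hd hord
    refine ⟨g, hg, fun z => ?_⟩
    rw [congrFun hfe z, hfg z]
    ring

theorem exists_div_prod (F : Finset ℂ) (T : ℕ) (f : ℂ → ℂ) (hf : Differentiable ℂ f)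
    (h : ∀ s ∈ F, (T : ℕ∞) ≤ analyticOrderAt f s) :
    ∃ g : ℂ → ℂ, Differentiable ℂ g ∧ ∀ z, f z = (∏ s ∈ F, (z - s) ^ T) * g z := by
  classical
  induction F using Finset.induction_on generalizing f with
  | empty => exact ⟨f, hf, by simp⟩
  | insert s F hs ih =>
    obtain ⟨g, hg, hfg⟩ := exists_div_pow f hf s T (h s (by simp))
    obtain ⟨g', hg', hgg⟩ := ih g hg (by
      intro t ht
      have h1 : analyticOrderAt f t
          = analyticOrderAt (fun z : ℂ => (z - s) ^ T) t + analyticOrderAt g t := by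
        rw [show f = fun z => (z - s) ^ T * g z from funext hfg]
        exact analyticOrderAt_mul (by fun_prop) (hg.analyticAt t)
      have h2 : analyticOrderAt (fun z : ℂ => (z - s) ^ T) t = 0 := by
        rw [analyticOrderAt_eq_zero]
        right
        have : t ≠ s := fun h => hs (h ▸ ht)
        exact pow_ne_zero _ (sub_ne_zero.2 this)
      have := h t (by simp [ht])
      rwa [h1, h2, zero_add] at this)
    refine ⟨g', hg', fun z => ?_⟩
    rw [hfg, hgg, Finset.prod_insert hs]
    ring

/-- Schwarz lemma with zeros of order `T` at `0, ..., S-1`. -/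
theorem schwarz_zeros (S T : ℕ) (f : ℂ → ℂ) (hf : Differentiable ℂ f)
    (h : ∀ s : ℕ, s < S → (T : ℕ∞) ≤ analyticOrderAt f s) (r : ℝ) (hr : (S : ℝ) ≤ r) (hr0 : 0 < r)
    (M : ℝ) (hM : ∀ z : ℂ, ‖z‖ = 7 * r → ‖f z‖ ≤ M) (z : ℂ) (hz : ‖z‖ ≤ r) :
    ‖f z‖ ≤ M * Real.exp (-(T * S : ℝ)) := by
  classical
  have inj : Function.Injective (fun n : ℕ => (n : ℂ)) := Nat.cast_injective
  obtain ⟨g, hg, hfg⟩ := exists_div_prod ((Finset.range S).image (fun n : ℕ => (n : ℂ))) T f hf (by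
    intro s hs
    simp only [Finset.mem_image, Finset.mem_range] at hs
    obtain ⟨n, hn, rfl⟩ := hs
    exact h n hn)
  simp only [Finset.prod_image inj.injOn] at hfg
  have hM0 : 0 ≤ M := (norm_nonneg _).trans (hM ((7 * r : ℝ) : ℂ) (by
    rw [Complex.norm_real, Real.norm_of_nonneg (by positivity)]))
  have hgz : ‖g z‖ ≤ M / (6 * r) ^ (T * S) := by
    refine Complex.norm_le_of_forall_mem_frontier_norm_le (U := Metric.ball 0 (7 * r))
      Metric.isBounded_ball hg.diffContOnCl ?_ ?_
    · intro w hw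
      rw [frontier_ball _ (by positivity)] at hw
      have hw' : ‖w‖ = 7 * r := by simpa using hw
      have h1 := hM w hw'
      rw [hfg, norm_mul] at h1
      have h2 : (6 * r) ^ (T * S) ≤ ‖∏ n ∈ Finset.range S, (w - (n : ℂ)) ^ T‖ := by
        rw [norm_prod, pow_mul]
        calc ((6 * r) ^ T) ^ S = ∏ n ∈ Finset.range S, (6 * r) ^ T := by simp
          _ ≤ _ := by
            refine Finset.prod_le_prod (fun _ _ => by positivity) fun n hn => ?_
            rw [norm_pow]
            gcongr
            have : (n : ℝ) ≤ r := le_trans (by exact_mod_cast (Finset.mem_range.1 hn).le) hr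
            have h3 := norm_sub_norm_le w (n : ℂ)
            rw [hw', Complex.norm_natCast] at h3
            linarith
      rw [le_div_iff₀ (by positivity), mul_comm]
      exact (mul_le_mul_of_nonneg_right h2 (norm_nonneg _)).trans h1
    · rw [closure_ball _ (by positivity)]
      simp
      linarith
  have h2 : ‖∏ n ∈ Finset.range S, (z - (n : ℂ)) ^ T‖ ≤ (2 * r) ^ (T * S) := by
    rw [norm_prod, pow_mul]
    calc _ ≤ ∏ n ∈ Finset.range S, (2 * r) ^ T := by
            refine Finset.prod_le_prod (fun _ _ => by positivity) fun n hn => ?_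
            rw [norm_pow]
            gcongr
            have : (n : ℝ) ≤ r := le_trans (by exact_mod_cast (Finset.mem_range.1 hn).le) hr
            have h3 := norm_sub_le z (n : ℂ)
            rw [Complex.norm_natCast] at h3
            linarith
      _ = ((2 * r) ^ T) ^ S := by simp
  rw [hfg, norm_mul]
  have h3 : (2 * r) ^ (T * S) / (6 * r) ^ (T * S) ≤ Real.exp (-(T * S : ℝ)) := by
    rw [← div_pow, show 2 * r / (6 * r) = 1 / 3 by field_simp; norm_num]
    have : (1 / 3 : ℝ) ≤ Real.exp (-1) := by
      rw [Real.exp_neg, one_div]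
      have := Real.exp_one_lt_d9
      gcongr
      linarith
    calc (1 / 3 : ℝ) ^ (T * S) ≤ Real.exp (-1) ^ (T * S) := by gcongr
      _ = _ := by rw [← Real.exp_nat_mul]; push_cast; ring_nf
  calc _ ≤ (2 * r) ^ (T * S) * (M / (6 * r) ^ (T * S)) := by gcongr
    _ = M * ((2 * r) ^ (T * S) / (6 * r) ^ (T * S)) := by ring
    _ ≤ _ := by gcongr

open Polynomial in
theorem exp_seq_zero {ι : Type*} [Fintype ι] (μ : ι → ℂ) (hμ : Function.Injective μ)
    (h0 : ∀ i, μ i ≠ 0) (M : ℕ) (D : ι → ℕ) (hD : ∑ i, D i = M) (P : ι → ℂ[X])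
    (hP : ∀ i, (P i).degree < D i)
    (h : ∀ s : ℕ, s < M → ∑ i, (P i).eval (s : ℂ) * μ i ^ s = 0) : ∀ i, P i = 0 := by
  classical
  induction M generalizing D P with
  | zero =>
    intro i
    have : D i = 0 := (Finset.sum_eq_zero_iff.1 hD) i (Finset.mem_univ i)
    have h1 := hP i
    rw [this] at h1
    simpa using h1
  | succ M ih =>
    obtain ⟨i0, hi0⟩ : ∃ i0, D i0 ≠ 0 := by
      by_contra! hc
      simp [hc] at hD
    set D' : ι → ℕ := Function.update D i0 (D i0 - 1) with hD'
    set Q : ι → ℂ[X] := fun i => C (μ i) * taylor 1 (P i) - C (μ i0) * P i with hQ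
    have hsum : ∑ i, D' i = M := by
      rw [hD', Finset.sum_update_of_mem (Finset.mem_univ i0)]
      have := Finset.add_sum_erase Finset.univ D (Finset.mem_univ i0)
      rw [← Finset.erase_eq]
      omega
    have hdeg : ∀ i, (Q i).degree < D' i := by
      intro i
      by_cases hi : i = i0
      · subst hi
        have e : Q i = C (μ i) * (taylor 1 (P i) - P i) := by rw [hQ]; ring
        rw [e, degree_C_mul (h0 i), hD', Function.update_self]
        by_cases hPi : P i = 0
        · simp [hPi]
        · have h1 : (taylor 1 (P i) - P i).degree < (P i).degree := by
            have := degree_sub_lt_left (p := taylor 1 (P i)) (q := P i) (by simp)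
              (by simpa using hPi) (by simp)
            simpa using this
          have h2 := hP i
          rw [degree_eq_natDegree hPi] at h1 h2
          refine h1.trans_le ?_
          norm_cast at h2 ⊢
          omega
      · rw [hD', Function.update_of_ne hi]
        refine (degree_sub_le _ _).trans_lt (max_lt ?_ ?_)
        · rw [degree_C_mul (h0 i)]
          simpa using hP i
        · rw [degree_C_mul (h0 i0)]
          exact hP i
    have hQ0 := ih D' hsum Q hdeg (by
      intro s hs
      have h1 := h (s + 1) (by omega)
      have h2 := h s (by omega)
      have : ∑ i, (Q i).eval (s : ℂ) * μ i ^ s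
          = ∑ i, (P i).eval ((s + 1 : ℕ) : ℂ) * μ i ^ (s + 1)
            - μ i0 * ∑ i, (P i).eval (s : ℂ) * μ i ^ s := by
        rw [Finset.mul_sum, ← Finset.sum_sub_distrib]
        refine Finset.sum_congr rfl fun i _ => ?_
        simp only [hQ, eval_sub, eval_mul, eval_C, taylor_eval]
        push_cast
        ring
      rw [this, h1, h2]
      simp)
    have hne : ∀ i, i ≠ i0 → P i = 0 := by
      intro i hi
      have h1 := hQ0 i
      have h2 : (Q i).coeff (P i).natDegree = (μ i - μ i0) * (P i).leadingCoeff := by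
        have : (taylor 1 (P i)).coeff (P i).natDegree = (P i).leadingCoeff := by
          have := leadingCoeff_taylor (f := P i) 1
          rwa [leadingCoeff, natDegree_taylor] at this
        simp only [hQ, coeff_sub, coeff_C_mul, this, coeff_natDegree]
        ring
      rw [h1, coeff_zero] at h2
      rcases mul_eq_zero.1 h2.symm with h3 | h3
      · exact absurd (hμ (sub_eq_zero.1 h3)) hi
      · simpa using h3
    intro i
    by_cases hi : i = i0
    · subst hi
      have e : taylor 1 (P i) = P i := by
        have := hQ0 i
        have e : Q i = C (μ i) * (taylor 1 (P i) - P i) := by rw [hQ]; ring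
        rw [e, mul_eq_zero] at this
        rcases this with h3 | h3
        · exact absurd (C_eq_zero.1 h3) (h0 i)
        · exact sub_eq_zero.1 h3
      have hz := h 0 (by omega)
      rw [Finset.sum_eq_single i (fun j _ hj => by simp [hne j hj]) (by simp)] at hz
      simp at hz
      have hev : ∀ n : ℕ, (P i).eval (n : ℂ) = 0 := by
        intro n
        induction n with
        | zero => simpa using hz
        | succ n ihn =>
          have := congrArg (eval (n : ℂ)) e
          rw [taylor_eval, ihn] at this
          push_cast
          exact this
      refine eq_zero_of_infinite_isRoot _ ?_
      refine Set.Infinite.mono (s := Set.range (fun n : ℕ => (n : ℂ))) ?_ ?_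
      · rintro _ ⟨n, rfl⟩
        exact hev n
      · exact Set.infinite_range_of_injective Nat.cast_injective
    · exact hne i hi

open Polynomial in
/-- End game: the coefficients vanish. -/
theorem endgame (L0 L S T : ℕ) (p : Fin L0 → Fin L → Fin L → ℂ) (d b1 b2 c1 c2 a : ℂ)
    (ha0 : a ≠ 0) (ha : ∀ i j : ℕ, a ^ i = a ^ j → i = j) (hbc : b2 ≠ 0 ∨ c2 ≠ 0)
    (hS : L0 * L ≤ S) (hT : L ≤ T)
    (h : ∀ m n s : ℕ, m + n < T → s < S → ∑ k : Fin L0, ∑ u : Fin L, ∑ v : Fin L,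
      p k u v * (u * c1 + v * c2) ^ n * bq d (u * b1 + v * b2) (s : ℂ) m k * a ^ (u * s : ℕ) = 0) :
    ∀ k u v, p k u v = 0 := by
  classical
  by_contra! hc
  obtain ⟨k0, u, v0, hne⟩ := hc
  have key : ∀ m n, m + n < T → ∑ k : Fin L0, ∑ v : Fin L,
      C (p k u v * (u * c1 + v * c2) ^ n) * bq (C d) (C (u * b1 + v * b2)) X m k = 0 := by
    intro m n hmn
    refine exp_seq_zero (fun u : Fin L => a ^ (u : ℕ)) (fun i j hij => Fin.ext (ha _ _ hij))
      (fun i => pow_ne_zero _ ha0) (L0 * L) (fun _ => L0) (by simp [mul_comm]) 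
      (fun u => ∑ k : Fin L0, ∑ v : Fin L,
        C (p k u v * (u * c1 + v * c2) ^ n) * bq (C d) (C (u * b1 + v * b2)) X m k) ?_ ?_ u
    · intro u
      refine (degree_sum_le _ _).trans_lt ?_
      rw [Finset.sup_lt_iff (WithBot.bot_lt_coe _)]
      intro k _
      refine (degree_sum_le _ _).trans_lt ?_
      rw [Finset.sup_lt_iff (WithBot.bot_lt_coe _)]
      intro v _
      refine (degree_le_natDegree).trans_lt ?_
      have := (natDegree_C_mul_le (p k u v * (u * c1 + v * c2) ^ n)
        (bq (C d) (C (u * b1 + v * b2)) X m k)).trans (bq_natDegree _ _ _ _)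
      have hk := k.2
      exact_mod_cast this.trans_lt hk
    · intro s hs
      rw [← h m n s hmn (hs.trans_le hS), Finset.sum_comm]
      refine Finset.sum_congr rfl fun u _ => ?_
      rw [eval_finsetSum, Finset.sum_mul]
      refine Finset.sum_congr rfl fun k _ => ?_
      rw [eval_finsetSum, Finset.sum_mul]
      refine Finset.sum_congr rfl fun v _ => ?_
      have := bq_map (evalRingHom (s : ℂ)) (C d) (C (u * b1 + v * b2)) X m k
      simp only [coe_evalRingHom, eval_C, eval_X] at this
      rw [eval_mul, eval_C, this, pow_mul]
  obtain ⟨K, hK, hKmax⟩ := Finset.exists_max_image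
    (Finset.univ.filter (fun k : Fin L0 => ∃ v, p k u v ≠ 0)) (fun k => k)
    ⟨k0, by simp; exact ⟨v0, hne⟩⟩
  simp only [Finset.mem_filter, Finset.mem_univ, true_and] at hK hKmax
  have coeffs : ∀ m n, m + n < T →
      ∑ v : Fin L, p K u v * (u * c1 + v * c2) ^ n * (u * b1 + v * b2) ^ m = 0 := by
    intro m n hmn
    have h1 := congrArg (fun q : ℂ[X] => q.coeff K) (key m n hmn)
    simp only [finsetSum_coeff, coeff_C_mul, coeff_zero] at h1
    rw [Finset.sum_eq_single K] at h1
    · simpa only [bq_coeff] using h1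
    · intro k _ hk
      refine Finset.sum_eq_zero fun v _ => ?_
      rcases lt_or_gt_of_ne hk with hlt | hgt
      · rw [coeff_eq_zero_of_natDegree_lt ((bq_natDegree _ _ _ _).trans_lt (by exact_mod_cast hlt)),
          mul_zero]
      · have : p k u v = 0 := by
          by_contra hcon
          exact absurd (hKmax k ⟨v, hcon⟩) (not_le.2 hgt)
        simp [this]
    · simp
  obtain ⟨v, hv⟩ := hK
  have inj : ∀ x y : ℂ, y ≠ 0 → Function.Injective (fun v : Fin L => (u * x + v * y : ℂ)) := by
    intro x y hy v w hvw
    have : (v : ℂ) * y = w * y := by simpa using hvw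
    have := mul_right_cancel₀ hy this
    exact Fin.ext (by exact_mod_cast this)
  rcases hbc with hb | hcc
  · have := Matrix.eq_zero_of_forall_pow_sum_mul_pow_eq_zero (v := fun v => p K u v) (inj b1 b2 hb)
      (fun i => by
        have := coeffs i 0 (by have := i.2; omega)
        simpa using this)
    exact hv (congrFun this v)
  · have := Matrix.eq_zero_of_forall_pow_sum_mul_pow_eq_zero (v := fun v => p K u v) (inj c1 c2 hcc)
      (fun i => by
        have := coeffs 0 i (by have := i.2; omega)
        simpa using this)
    exact hv (congrFun this v)

/-- the auxiliary functions -/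
noncomputable def auxG {ι : Type*} [Fintype ι] (d : ℂ) (p B C w : ι → ℂ) (k : ι → ℕ) (m n : ℕ)
    (z : ℂ) : ℂ :=
  ∑ i, p i * C i ^ n * bq d (B i) z m (k i) * Complex.exp (w i * z)

theorem auxG_hasDerivAt {ι : Type*} [Fintype ι] (d η : ℂ) (hd : d ≠ 0) (p B C w : ι → ℂ)
    (k : ι → ℕ) (hw : ∀ i, d * w i = B i + η * C i) (m n : ℕ) (z : ℂ) :
    HasDerivAt (auxG d p B C w k m n)
      (d⁻¹ * (auxG d p B C w k (m + 1) n z + η * auxG d p B C w k m (n + 1) z)) z := by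
  have h : HasDerivAt (auxG d p B C w k m n)
      (∑ i, p i * C i ^ n * (k i * bq d (B i) z m (k i - 1) * Complex.exp (w i * z)
        + bq d (B i) z m (k i) * (Complex.exp (w i * z) * w i))) z := by
    unfold auxG
    refine HasDerivAt.fun_sum fun i _ => ?_
    have h1 := bq_hasDerivAt d (B i) z m (k i)
    have h2 : HasDerivAt (fun z => Complex.exp (w i * z)) (Complex.exp (w i * z) * w i) z := by
      have := ((hasDerivAt_id z).const_mul (w i)).cexp
      simpa using this
    have h3 := (h1.mul h2).const_mul (p i * C i ^ n)
    refine (h3.congr_of_eventuallyEq (Filter.Eventually.of_forall fun y => ?_))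
    simp only [Pi.mul_apply]
    ring
  refine h.congr_deriv ?_
  unfold auxG
  rw [Finset.mul_sum, ← Finset.sum_add_distrib, Finset.mul_sum]
  refine Finset.sum_congr rfl fun i _ => ?_
  have h4 : w i = d⁻¹ * (B i + η * C i) := by rw [← hw i]; field_simp
  rw [bq, h4]
  field_simp
  ring

theorem auxG_differentiable {ι : Type*} [Fintype ι] (d η : ℂ) (hd : d ≠ 0) (p B C w : ι → ℂ)
    (k : ι → ℕ) (hw : ∀ i, d * w i = B i + η * C i) (m n : ℕ) :
    Differentiable ℂ (auxG d p B C w k m n) :=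
  fun z => (auxG_hasDerivAt d η hd p B C w k hw m n z).differentiableAt

theorem auxG_iteratedDeriv {ι : Type*} [Fintype ι] (d η : ℂ) (hd : d ≠ 0) (p B C w : ι → ℂ)
    (k : ι → ℕ) (hw : ∀ i, d * w i = B i + η * C i) (T : ℕ) (s : ℂ)
    (h : ∀ m n, m + n < T → auxG d p B C w k m n s = 0) (j : ℕ) :
    ∀ m n, m + n + j < T → iteratedDeriv j (auxG d p B C w k m n) s = 0 := by
  induction j with
  | zero => intro m n hmn; simpa using h m n hmn
  | succ j ih =>
    intro m n hmn
    rw [iteratedDeriv_succ']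
    have : deriv (auxG d p B C w k m n) = fun z => d⁻¹ * (auxG d p B C w k (m + 1) n z
        + η * auxG d p B C w k m (n + 1) z) :=
      funext fun z => (auxG_hasDerivAt d η hd p B C w k hw m n z).deriv
    rw [this]
    have c1 : ContDiffAt ℂ j (auxG d p B C w k (m + 1) n) s :=
      ((auxG_differentiable d η hd p B C w k hw (m + 1) n).analyticAt s).contDiffAt
    have c2 : ContDiffAt ℂ j (auxG d p B C w k m (n + 1)) s :=
      ((auxG_differentiable d η hd p B C w k hw m (n + 1)).analyticAt s).contDiffAt
    rw [iteratedDeriv_const_mul_field, iteratedDeriv_fun_add c1 (contDiffAt_const.mul c2),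
      iteratedDeriv_const_mul_field, ih (m + 1) n (by omega), ih m (n + 1) (by omega)]
    simp

theorem auxG_small {ι : Type*} [Fintype ι] (d η : ℂ) (hd : d ≠ 0) (p B C w : ι → ℂ)
    (k : ι → ℕ) (hw : ∀ i, d * w i = B i + η * C i) (T S : ℕ)
    (h : ∀ m n s : ℕ, m + n < 2 * T → s < S → auxG d p B C w k m n s = 0)
    (r : ℝ) (hr : (S : ℝ) ≤ r) (hr0 : 0 < r) (m n : ℕ) (hmn : m + n < T)
    (M : ℝ) (hM : ∀ z : ℂ, ‖z‖ = 7 * r → ‖auxG d p B C w k m n z‖ ≤ M) (z : ℂ) (hz : ‖z‖ ≤ r) :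
    ‖auxG d p B C w k m n z‖ ≤ M * Real.exp (-(T * S : ℝ)) := by
  refine schwarz_zeros S T _ (auxG_differentiable d η hd p B C w k hw m n) ?_ r hr hr0 M hM z hz
  intro s hs
  rw [natCast_le_analyticOrderAt_iff_iteratedDeriv_eq_zero
    ((auxG_differentiable d η hd p B C w k hw m n).analyticAt _)]
  intro i hi
  exact auxG_iteratedDeriv d η hd p B C w k hw (2 * T) s (fun m n hmn => h m n s hmn hs) i m n
    (by omega)

theorem auxG_norm_le {ι : Type*} [Fintype ι] (d : ℂ) (p B C w : ι → ℂ)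
    (k : ι → ℕ) (P Q : ℝ) (L0 : ℕ) (W ρ : ℝ) (hρ : 1 ≤ ρ) (hQ : 1 ≤ Q) (T : ℕ)
    (hp : ∀ i, ‖p i‖ ≤ P) (hC : ∀ i, ‖C i‖ ≤ Q) (hk : ∀ i, k i ≤ L0)
    (hB : ∀ i, ‖d‖ * k i + ‖B i‖ ≤ Q) (hW : ∀ i, ‖w i‖ ≤ W) (m n : ℕ) (hmn : m + n ≤ T)
    (z : ℂ) (hz : ‖z‖ ≤ ρ) :
    ‖auxG d p B C w k m n z‖ ≤ Fintype.card ι * (P * Q ^ T * ρ ^ L0 * Real.exp (W * ρ)) := by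
  unfold auxG
  refine (norm_sum_le _ _).trans ?_
  rw [← nsmul_eq_mul, Fintype.card, ← Finset.sum_const]
  refine Finset.sum_le_sum fun i _ => ?_
  have hP0 : 0 ≤ P := (norm_nonneg _).trans (hp i)
  rw [norm_mul, norm_mul, norm_mul, norm_pow]
  have h1 := bq_norm_le d (B i) z ρ hρ hz m (k i)
  have h2 : ‖Complex.exp (w i * z)‖ ≤ Real.exp (W * ρ) := by
    rw [Complex.norm_exp]
    refine Real.exp_le_exp.2 ((Complex.re_le_norm _).trans ?_)
    rw [norm_mul]
    have := hW i
    gcongr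
    exact (norm_nonneg _).trans this
  calc _ ≤ P * Q ^ n * (Q ^ m * ρ ^ L0) * Real.exp (W * ρ) := by
        gcongr
        · exact hp i
        · exact hC i
        · refine h1.trans ?_
          gcongr
          · exact hB i
          · exact hk i
    _ = P * Q ^ (m + n) * ρ ^ L0 * Real.exp (W * ρ) := by ring
    _ ≤ _ := by gcongr

section BakerParts

open NumberField

theorem house_le_of_forall {K : Type*} [Field K] [NumberField K] (x : K) (b : ℝ) 
    (h : ∀ τ : K →+* ℂ, ‖τ x‖ ≤ b) : house x ≤ b := by
  have hb : 0 ≤ b := (norm_nonneg _).trans (h (Classical.arbitrary _))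
  rw [house, pi_norm_le_iff_of_nonneg hb]
  intro τ
  exact h τ

theorem liouville_house {K : Type*} [Field K] [NumberField K] (σ : K →+* ℂ) (x : 𝓞 K)
    (hx : x ≠ 0) : 1 ≤ ‖σ x‖ * house (x : K) ^ (Module.finrank ℚ K - 1) := by
  refine le_trans ?_ (norm_norm_le_norm_mul_house_pow (x : K) σ)
  have h1 : Algebra.norm ℤ x ≠ 0 := by simpa [Algebra.norm_eq_zero_iff] using hx
  rw [← Algebra.coe_norm_int]
  have : (1 : ℝ) ≤ |((Algebra.norm ℤ x : ℤ) : ℝ)| := by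
    exact_mod_cast Int.one_le_abs h1
  simpa [Int.norm_eq_abs] using this

/-- coefficient of the linear system -/
noncomputable def cA {R : Type*} [CommRing R] (L : ℕ) (d b1 b2 c1 c2 : R) (num den : ℕ) (m n s : ℕ)
    (k u v : ℕ) : R :=
  (u * c1 + v * c2) ^ n * bq d (u * b1 + v * b2) (s : R) m k * num ^ (u * s) * den ^ ((L - u) * s)

theorem cA_map {R S : Type*} [CommRing R] [CommRing S] (f : R →+* S) (L : ℕ) (d b1 b2 c1 c2 : R)
    (num den : ℕ) (m n s k u v : ℕ) :
    f (cA L d b1 b2 c1 c2 num den m n s k u v)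
      = cA L (f d) (f b1) (f b2) (f c1) (f c2) num den m n s k u v := by
  simp [cA, bq_map]

theorem cA_norm_le (L L0 : ℕ) (d b1 b2 c1 c2 : ℂ) (num den : ℕ) (m n s k u v : ℕ) (hu : u < L)
    (hv : v < L) (hk : k < L0) (hL : L ≤ L0) (H : ℝ) (hd : ‖d‖ ≤ H) (hb1 : ‖b1‖ ≤ H)
    (hb2 : ‖b2‖ ≤ H) (hc1 : ‖c1‖ ≤ H) (hc2 : ‖c2‖ ≤ H) (a0 : ℕ) (ha0 : 1 ≤ a0) (hnum : num ≤ a0)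
    (hden : den ≤ a0) (r : ℕ) (hr : 1 ≤ r) (hs : s ≤ r) :
    ‖cA L d b1 b2 c1 c2 num den m n s k u v‖ ≤
      (3 * H * L0) ^ (m + n) * (r : ℝ) ^ L0 * (a0 : ℝ) ^ (L * r) := by
  have hH : 0 ≤ H := (norm_nonneg _).trans hd
  have huR : (u : ℝ) ≤ L0 := by exact_mod_cast (hu.le.trans hL)
  have hvR : (v : ℝ) ≤ L0 := by exact_mod_cast (hv.le.trans hL)
  have hkR : (k : ℝ) ≤ L0 := by exact_mod_cast hk.le
  have hrR : (1 : ℝ) ≤ r := by exact_mod_cast hr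
  have e1 : ∀ x y : ℂ, ‖x‖ ≤ H → ‖y‖ ≤ H → ‖(u * x + v * y : ℂ)‖ ≤ 2 * H * L0 := by
    intro x y hx hy
    refine (norm_add_le _ _).trans ?_
    rw [norm_mul, norm_mul, Complex.norm_natCast, Complex.norm_natCast]
    calc (u : ℝ) * ‖x‖ + v * ‖y‖ ≤ L0 * H + L0 * H := by gcongr
      _ = _ := by ring
  have e2 : 2 * H * L0 ≤ 3 * H * L0 := by gcongr; norm_num
  have e3 : ‖d‖ * k + ‖(u * b1 + v * b2 : ℂ)‖ ≤ 3 * H * L0 := by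
    have := e1 b1 b2 hb1 hb2
    calc ‖d‖ * k + ‖(u * b1 + v * b2 : ℂ)‖ ≤ H * L0 + 2 * H * L0 := by gcongr
      _ = _ := by ring
  have e4 := bq_norm_le d (u * b1 + v * b2) (s : ℂ) r hrR (by simpa using hs) m k
  have e5 : (num : ℝ) ^ (u * s) * (den : ℝ) ^ ((L - u) * s) ≤ (a0 : ℝ) ^ (L * r) := by
    calc (num : ℝ) ^ (u * s) * (den : ℝ) ^ ((L - u) * s) 
        ≤ (a0 : ℝ) ^ (u * s) * (a0 : ℝ) ^ ((L - u) * s) := by gcongr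
      _ = (a0 : ℝ) ^ (L * s) := by rw [← pow_add, ← add_mul, Nat.add_sub_cancel' hu.le]
      _ ≤ _ := by
        apply pow_le_pow_right₀ (by exact_mod_cast ha0)
        gcongr
  unfold cA
  rw [mul_assoc, norm_mul, norm_mul, norm_mul, norm_pow, norm_pow, norm_pow, Complex.norm_natCast,
    Complex.norm_natCast]
  calc _ ≤ (3 * H * L0) ^ n * ((3 * H * L0) ^ m * (r : ℝ) ^ L0) * (a0 : ℝ) ^ (L * r) := by
        gcongr
        · exact (e1 c1 c2 hc1 hc2).trans e2
        · refine e4.trans ?_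
          gcongr
    _ = _ := by ring

theorem baker_step {K : Type*} [Field K] [NumberField K] (σ : K →+* ℂ) (d b1 b2 c1 c2 : 𝓞 K)
    (hd : d ≠ 0) (η ℓ ω : ℂ) (hℓ : σ d * ℓ = σ b1 + η * σ c1) (hω : σ d * ω = σ b2 + η * σ c2)
    (num den : ℕ) (hden0 : 0 < den) (heℓ : Complex.exp ℓ = num / den) (heω : Complex.exp ω = 1)
    (H : ℝ) (hH : 1 ≤ H) (hHd : house (d : K) ≤ H) (hHb1 : house (b1 : K) ≤ H)
    (hHb2 : house (b2 : K) ≤ H)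
    (hHc1 : house (c1 : K) ≤ H) (hHc2 : house (c2 : K) ≤ H) (a0 : ℕ) (ha0 : 1 ≤ a0) (hnum : num ≤ a0)
    (hden : den ≤ a0) (W : ℝ) (hW : ‖ℓ‖ + ‖ω‖ ≤ W)
    (L0 L : ℕ) (hLpos : 1 ≤ L) (hL : L ≤ L0) (p : Fin L0 × Fin L × Fin L → 𝓞 K) (P : ℝ)
    (hp : ∀ i, house (p i : K) ≤ P)
    (T S S' : ℕ) (hS' : 1 ≤ S') (hSS' : S ≤ S')
    (hzero : ∀ m n s : ℕ, m + n < 2 * T → s < S → ∑ i : Fin L0 × Fin L × Fin L,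
      p i * cA L d b1 b2 c1 c2 num den m n s i.1 i.2.1 i.2.2 = 0)
    (V : ℝ) (hV1 : 1 ≤ V)
    (hVG : (L0 * (L * L) : ℝ) * (P * (3 * H * L0) ^ T * (7 * S' : ℝ) ^ L0 *
      Real.exp (W * L * (7 * S'))) ≤ V)
    (hVA : (L0 * (L * L) : ℝ) * (P * ((3 * H * L0) ^ T * (S' : ℝ) ^ L0 * (a0 : ℝ) ^ (L * S'))) ≤ V)
    (hVd : (a0 : ℝ) ^ (L * S') ≤ V)
    (hfin : V ^ (Module.finrank ℚ K + 1) < Real.exp (T * S)) :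
    ∀ m n s : ℕ, m + n < T → s < S' → ∑ i : Fin L0 × Fin L × Fin L,
      p i * cA L d b1 b2 c1 c2 num den m n s i.1 i.2.1 i.2.2 = 0 := by
  have hσd : σ d ≠ 0 := by
    rw [map_ne_zero]
    simpa using hd
  have hQ1 : 1 ≤ 3 * H * L0 := by
    have : (1 : ℝ) ≤ L0 := by exact_mod_cast hLpos.trans hL
    nlinarith
  have hP0 : 0 ≤ P := (house_nonneg _).trans
    (hp (⟨0, by omega⟩, ⟨0, by omega⟩, ⟨0, by omega⟩))
  have hdenC : (den : ℂ) ≠ 0 := by exact_mod_cast hden0.ne'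
  have hS'R : (1 : ℝ) ≤ S' := by exact_mod_cast hS'
  let pc : Fin L0 × Fin L × Fin L → ℂ := fun i => σ (p i)
  let B : Fin L0 × Fin L × Fin L → ℂ := fun i => (i.2.1 : ℕ) * σ b1 + (i.2.2 : ℕ) * σ b2
  let C : Fin L0 × Fin L × Fin L → ℂ := fun i => (i.2.1 : ℕ) * σ c1 + (i.2.2 : ℕ) * σ c2
  let w : Fin L0 × Fin L × Fin L → ℂ := fun i => (i.2.1 : ℕ) * ℓ + (i.2.2 : ℕ) * ω
  let kk : Fin L0 × Fin L × Fin L → ℕ := fun i => i.1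
  have hw : ∀ i, σ d * w i = B i + η * C i := by
    intro i
    simp only [w, B, C]
    linear_combination ((i.2.1 : ℕ) : ℂ) * hℓ + ((i.2.2 : ℕ) : ℂ) * hω
  have hcard : (Fintype.card (Fin L0 × Fin L × Fin L) : ℝ) = L0 * (L * L) := by simp
  have hrel : ∀ m n s : ℕ, σ ((∑ i : Fin L0 × Fin L × Fin L,
      p i * cA L d b1 b2 c1 c2 num den m n s i.1 i.2.1 i.2.2 : 𝓞 K) : K)
      = (den : ℂ) ^ (L * s) * auxG (σ d) pc B C w kk m n s := by
    intro m n s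
    have e0 : ∀ x : 𝓞 K, σ (x : K) = (σ.comp (algebraMap (𝓞 K) K)) x := fun x => rfl
    rw [e0, map_sum, auxG, Finset.mul_sum]
    refine Finset.sum_congr rfl fun i _ => ?_
    rw [map_mul, cA_map, cA]
    have e1 : Complex.exp (w i * s) = (num : ℂ) ^ ((i.2.1 : ℕ) * s) / (den : ℂ) ^ ((i.2.1 : ℕ) * s) := by
      have : w i * s = ((i.2.1 * s : ℕ) : ℂ) * ℓ + ((i.2.2 * s : ℕ) : ℂ) * ω := by
        simp only [w]; push_cast; ring
      rw [this, Complex.exp_add, Complex.exp_nat_mul, Complex.exp_nat_mul, heℓ, heω, one_pow,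
        mul_one, div_pow]
    have e2 : (den : ℂ) ^ (L * s) = (den : ℂ) ^ ((i.2.1 : ℕ) * s) * (den : ℂ) ^ ((L - i.2.1) * s) := by
      rw [← pow_add, ← add_mul, Nat.add_sub_cancel' i.2.1.2.le]
    rw [e1, e2]
    simp only [pc, B, C, kk, ← e0]
    field_simp
  have hz' : ∀ m n s : ℕ, m + n < 2 * T → s < S → auxG (σ d) pc B C w kk m n s = 0 := by
    intro m n s hmn hs
    have h1 := hrel m n s
    rw [hzero m n s hmn hs] at h1
    simp only [map_zero] at h1
    rcases mul_eq_zero.1 h1.symm with h2 | h2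
    · exact absurd h2 (pow_ne_zero _ hdenC)
    · exact h2
  intro m n s hmn hs
  by_contra hne
  set x : 𝓞 K := ∑ i : Fin L0 × Fin L × Fin L,
      p i * cA L d b1 b2 c1 c2 num den m n s i.1 i.2.1 i.2.2 with hx
  have hcbd : ∀ τ : K →+* ℂ, ∀ i : Fin L0 × Fin L × Fin L,
      ‖τ (cA L d b1 b2 c1 c2 num den m n s i.1 i.2.1 i.2.2 : 𝓞 K)‖ ≤
        (3 * H * L0) ^ T * (S' : ℝ) ^ L0 * (a0 : ℝ) ^ (L * S') := by
    intro τ i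
    have e0 : ∀ x : 𝓞 K, τ (x : K) = (τ.comp (algebraMap (𝓞 K) K)) x := fun x => rfl
    have hb : ∀ y : 𝓞 K, house (y : K) ≤ H → ‖(τ.comp (algebraMap (𝓞 K) K)) y‖ ≤ H :=
      fun y hy => (norm_embedding_le_house _ τ).trans hy
    rw [e0, cA_map]
    refine (cA_norm_le L L0 _ _ _ _ _ num den m n s _ _ _ i.2.1.2 i.2.2.2 i.1.2 hL H (hb _ hHd)
      (hb _ hHb1) (hb _ hHb2) (hb _ hHc1) (hb _ hHc2) a0 ha0 hnum hden S' hS' hs.le).trans ?_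
    gcongr
  have hhouse : house (x : K) ≤ V := by
    refine house_le_of_forall _ _ fun τ => ?_
    refine le_trans ?_ hVA
    have e0 : ∀ x : 𝓞 K, τ (x : K) = (τ.comp (algebraMap (𝓞 K) K)) x := fun x => rfl
    rw [e0, hx, map_sum]
    refine (norm_sum_le _ _).trans ?_
    rw [← hcard, ← nsmul_eq_mul, Fintype.card, ← Finset.sum_const]
    refine Finset.sum_le_sum fun i _ => ?_
    rw [map_mul, norm_mul]
    gcongr
    · exact (norm_embedding_le_house _ τ).trans (hp i)
    · exact hcbd τ i
  have hG : ‖auxG (σ d) pc B C w kk m n s‖ ≤ V * Real.exp (-(T * S : ℝ)) := by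
    refine auxG_small (σ d) η hσd pc B C w kk hw T S hz' S' (by exact_mod_cast hSS') (by linarith)
      m n hmn V ?_ s (by simpa using hs.le)
    intro z hz
    refine le_trans ?_ hVG
    rw [← hcard]
    have hnb : ∀ y : 𝓞 K, house (y : K) ≤ H → ‖σ y‖ ≤ H :=
      fun y hy => (norm_embedding_le_house _ σ).trans hy
    have hLR : (L : ℝ) ≤ L0 := by exact_mod_cast hL
    have e1 : ∀ i : Fin L0 × Fin L × Fin L, ∀ x y : ℂ, ‖x‖ ≤ H → ‖y‖ ≤ H →
        ‖((i.2.1 : ℕ) * x + (i.2.2 : ℕ) * y : ℂ)‖ ≤ 2 * H * L0 := by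
      intro i x y hx hy
      have h1 : ((i.2.1 : ℕ) : ℝ) ≤ L0 := le_trans (by exact_mod_cast i.2.1.2.le) hLR
      have h2 : ((i.2.2 : ℕ) : ℝ) ≤ L0 := le_trans (by exact_mod_cast i.2.2.2.le) hLR
      refine (norm_add_le _ _).trans ?_
      rw [norm_mul, norm_mul, Complex.norm_natCast, Complex.norm_natCast]
      calc _ ≤ L0 * H + L0 * H := by gcongr
        _ = _ := by ring
    refine auxG_norm_le (σ d) pc B C w kk P (3 * H * L0) L0 (W * L) (7 * S') (by linarith) hQ1 T
      (fun i => (norm_embedding_le_house _ σ).trans (hp i)) ?_ (fun i => i.1.2.le) ?_ ?_ m n hmn.le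
      z hz.le
    · intro i
      refine (e1 i _ _ (hnb _ hHc1) (hnb _ hHc2)).trans ?_
      gcongr; norm_num
    · intro i
      have h1 := e1 i _ _ (hnb _ hHb1) (hnb _ hHb2)
      have h2 : ((kk i : ℕ) : ℝ) ≤ L0 := by exact_mod_cast i.1.2.le
      have h3 := hnb _ hHd
      calc ‖σ d‖ * kk i + ‖B i‖ ≤ H * L0 + 2 * H * L0 := by gcongr
        _ = _ := by ring
    · intro i
      have h1 : ((i.2.1 : ℕ) : ℝ) ≤ L := by exact_mod_cast i.2.1.2.le
      have h2 : ((i.2.2 : ℕ) : ℝ) ≤ L := by exact_mod_cast i.2.2.2.le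
      refine (norm_add_le _ _).trans ?_
      rw [norm_mul, norm_mul, Complex.norm_natCast, Complex.norm_natCast]
      calc _ ≤ L * ‖ℓ‖ + L * ‖ω‖ := by gcongr
        _ = (‖ℓ‖ + ‖ω‖) * L := by ring
        _ ≤ _ := by gcongr
  have hσx : ‖σ x‖ ≤ V * (V * Real.exp (-(T * S : ℝ))) := by
    rw [hrel m n s, norm_mul, norm_pow, Complex.norm_natCast]
    gcongr
    refine le_trans ?_ hVd
    calc (den : ℝ) ^ (L * s) ≤ (a0 : ℝ) ^ (L * s) := by gcongr
      _ ≤ _ := by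
        apply pow_le_pow_right₀ (by exact_mod_cast ha0)
        gcongr
  have hl := liouville_house σ x hne
  have hpos : 0 < Module.finrank ℚ K := Module.finrank_pos
  have : (1 : ℝ) ≤ V ^ (Module.finrank ℚ K + 1) * Real.exp (-(T * S : ℝ)) := by
    calc (1 : ℝ) ≤ _ := hl
      _ ≤ V * (V * Real.exp (-(T * S : ℝ))) * V ^ (Module.finrank ℚ K - 1) := by
        gcongr
        · exact pow_nonneg (house_nonneg (x : K)) _
        · exact house_nonneg (x : K)
      _ = V ^ (Module.finrank ℚ K - 1 + 2) * Real.exp (-(T * S : ℝ)) := by ring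
      _ = _ := by congr 2; omega
  rw [Real.exp_neg, ← div_eq_mul_inv, le_div_iff₀ (Real.exp_pos _)] at this
  linarith

theorem siegel_house (K : Type*) [Field K] [NumberField K] :
    ∃ c : ℝ, 1 ≤ c ∧ ∀ (α β : Type) [Fintype α] [Fintype β] (a : Matrix α β (𝓞 K)) (p : ℕ)
      (_ : 0 < p) (_ : Fintype.card α = p) (_ : Fintype.card β = 2 * p) (A : ℝ) (_ : 1 ≤ A)
      (_ : ∀ k l, house (algebraMap (𝓞 K) K (a k l)) ≤ A),
      ∃ ξ : β → 𝓞 K, ξ ≠ 0 ∧ a.mulVec ξ = 0 ∧ ∀ l, house (ξ l : K) ≤ c * (c * (2 * p) * A) := by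
  classical
  have key : ∃ c : ℝ, ∀ (α β : Type) [Fintype α] [Fintype β] (a : Matrix α β (𝓞 K)) (ha : a ≠ 0)
      (p : ℕ)
      (_ : 0 < p) (_ : Fintype.card α = p) (_ : Fintype.card β = 2 * p) (A : ℝ) 
      (_ : ∀ k l, house (algebraMap (𝓞 K) K (a k l)) ≤ A),
      ∃ ξ : β → 𝓞 K, ξ ≠ 0 ∧ a.mulVec ξ = 0 ∧ ∀ l, house (ξ l : K) ≤
        c * ((c * (2 * p : ℕ) * A) ^ ((p : ℝ) / ((2 * p : ℕ) - p))) := by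
    apply Exists.intro
    intro α β _ _ a ha p hp hα hβ A habs
    exact house.exists_ne_zero_int_vec_house_le K a ha hp (by omega) hβ habs hα
  obtain ⟨c, hc⟩ := key
  refine ⟨max 1 |c|, le_max_left _ _, ?_⟩
  intro α β _ _ a p hp hα hβ A hA habs
  have hm1 : (1 : ℝ) ≤ max 1 |c| := le_max_left _ _
  have hp1 : (1 : ℝ) ≤ p := by exact_mod_cast hp
  by_cases ha : a = 0
  · have : Nonempty β := Fintype.card_pos_iff.1 (by omega)
    refine ⟨fun _ => 1, ?_, by simp [ha], fun l => ?_⟩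
    · intro h
      exact one_ne_zero (congrFun h (Classical.arbitrary β))
    · have : house ((1 : 𝓞 K) : K) = 1 := by
        have := house_intCast (K := K) 1
        simpa using this
      rw [this]
      have h2 : 1 ≤ max 1 |c| * (2 * p) * A := by
        have : 1 ≤ max 1 |c| * (2 * p) := by nlinarith
        nlinarith
      nlinarith
  · obtain ⟨ξ, h1, h2, h3⟩ := hc α β a ha p hp hα hβ A habs
    refine ⟨ξ, h1, h2, fun l => (h3 l).trans ?_⟩
    have e : (p : ℝ) / ((2 * p : ℕ) - p) = 1 := by
      push_cast
      have : (2 * p - p : ℝ) = p := by ring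
      rw [this]
      field_simp
    rw [e, Real.rpow_one]
    refine (le_abs_self _).trans ?_
    rw [abs_mul, abs_mul, abs_mul, abs_of_nonneg (by linarith : (0 : ℝ) ≤ A),
      abs_of_nonneg (by positivity : (0 : ℝ) ≤ ((2 * p : ℕ) : ℝ))]
    push_cast
    gcongr <;> exact le_max_right _ _

theorem exists_big (M : ℝ) : ∃ X : ℕ, M ≤ X ∧ M ≤ Real.log X ∧ M * Real.log X < X := by
  have h1 : ∀ᶠ x : ℝ in Filter.atTop, M ≤ x := Filter.eventually_ge_atTop M
  have h2 : ∀ᶠ x : ℝ in Filter.atTop, M ≤ Real.log x :=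
    Real.tendsto_log_atTop.eventually (Filter.eventually_ge_atTop M)
  have h3 : ∀ᶠ x : ℝ in Filter.atTop, M * Real.log x < x := by
    have := (Real.isLittleO_log_id_atTop.def
      (show (0 : ℝ) < 1 / (2 * (|M| + 1)) by positivity))
    filter_upwards [this, Filter.eventually_gt_atTop 1] with x hx hx1
    have hl : 0 ≤ Real.log x := Real.log_nonneg hx1.le
    simp only [id, Real.norm_eq_abs, abs_of_nonneg hl, abs_of_pos (by linarith : 0 < x)] at hx
    have h4 : 2 * (|M| + 1) * Real.log x ≤ x := by
      calc 2 * (|M| + 1) * Real.log x ≤ 2 * (|M| + 1) * (1 / (2 * (|M| + 1)) * x) := by gcongr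
        _ = x := by field_simp
    have h5 : M * Real.log x ≤ |M| * Real.log x := by gcongr; exact le_abs_self M
    have h6 : 0 ≤ |M| * Real.log x := by positivity
    have h7 : 0 < Real.log x := Real.log_pos hx1
    nlinarith
  obtain ⟨X, hX⟩ := ((tendsto_natCast_atTop_atTop (R := ℝ)).eventually
    (h1.and (h2.and h3))).exists
  exact ⟨X, hX.1, hX.2.1, hX.2.2⟩

theorem step_num (X : ℕ) (h : ℕ) (c H W P : ℝ) (a0 : ℕ) (hc1 : 1 ≤ c) (hc : c ≤ X) (hH1 : 1 ≤ H)
    (hH : 3 * H ≤ X) (ha0 : 1 ≤ a0) (haX : (a0 : ℝ) ≤ X) (hX : 2048 ≤ X)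
    (hW : 7 * W ≤ Real.log X) 
    (hh : 1000 * (h + 1) * Real.log X < X) (hP0 : 0 ≤ P) (hP : P ≤ (X : ℝ) ^ (730 * X ^ 10))
    (k t : ℕ) (hk : k ≤ 4) (ht1 : 1 ≤ t) (ht : t ≤ 16) (L0 L T S S' : ℕ)
    (hL0 : L0 = 2048 * X ^ 9) (hL : L = X ^ 6) (hT : T = t * X ^ 10) (hS : S = X ^ (1 + 3 * k))
    (hS' : S' = X ^ (4 + 3 * k)) :
    (L0 * (L * L) : ℝ) * (P * (3 * H * L0) ^ T * (7 * S' : ℝ) ^ L0 *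
      Real.exp (W * L * (7 * S'))) ≤ (X : ℝ) ^ (1000 * X ^ (10 + 3 * k)) ∧
    (L0 * (L * L) : ℝ) * (P * ((3 * H * L0) ^ T * (S' : ℝ) ^ L0 * (a0 : ℝ) ^ (L * S'))) ≤
      (X : ℝ) ^ (1000 * X ^ (10 + 3 * k)) ∧
    (a0 : ℝ) ^ (L * S') ≤ (X : ℝ) ^ (1000 * X ^ (10 + 3 * k)) ∧
    ((X : ℝ) ^ (1000 * X ^ (10 + 3 * k))) ^ (h + 1) < Real.exp (T * S) := by
  have hXR : (2048 : ℝ) ≤ X := by exact_mod_cast hX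
  have hX1 : (1 : ℝ) ≤ X := by linarith
  have hXpos : (0 : ℝ) < X := by linarith
  have hXe : (X : ℝ) = Real.exp (Real.log X) := (Real.exp_log hXpos).symm
  have hXn : 1 ≤ X := by omega
  have b0 : (L0 : ℝ) ≤ (X : ℝ) ^ 10 := by
    rw [hL0]; push_cast
    calc (2048 * (X : ℝ) ^ 9) ≤ X * (X : ℝ) ^ 9 := by gcongr
      _ = _ := by ring
  have b0n : L0 ≤ X ^ 10 := by exact_mod_cast b0
  have bN : (L0 * (L * L) : ℝ) ≤ (X : ℝ) ^ 22 := by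
    calc (L0 * (L * L) : ℝ) ≤ (X : ℝ) ^ 10 * (L * L) := by gcongr
      _ = _ := by rw [hL]; push_cast; ring
  have bQ : 3 * H * L0 ≤ (X : ℝ) ^ 11 := by
    calc 3 * H * L0 ≤ X * (X : ℝ) ^ 10 := by gcongr
      _ = _ := by ring
  have bS : (S' : ℝ) ≤ (X : ℝ) ^ 16 := by
    rw [hS']; push_cast
    exact pow_le_pow_right₀ hX1 (by omega)
  have b7S : 7 * (S' : ℝ) ≤ (X : ℝ) ^ 17 := by
    calc 7 * (S' : ℝ) ≤ X * (X : ℝ) ^ 16 := by gcongr; linarith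
      _ = _ := by ring
  have hE : X ^ 10 ≤ X ^ (10 + 3 * k) := Nat.pow_le_pow_right hXn (by omega)
  have hE1 : 1 ≤ X ^ 10 := Nat.one_le_pow _ _ hXn
  have hLS : L * S' = X ^ (10 + 3 * k) := by
    rw [hL, hS']; ring
  have hT16 : T ≤ 16 * X ^ 10 := by rw [hT]; gcongr
  have bQT : (3 * H * L0) ^ T ≤ (X : ℝ) ^ (11 * T) := by
    rw [pow_mul]; gcongr
  have b7 : (7 * (S' : ℝ)) ^ L0 ≤ (X : ℝ) ^ (17 * L0) := by
    rw [pow_mul]; gcongr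
  have bs : (S' : ℝ) ^ L0 ≤ (X : ℝ) ^ (17 * L0) := by
    refine le_trans ?_ b7
    gcongr
    have : (0 : ℝ) ≤ S' := by positivity
    linarith
  have ba : (a0 : ℝ) ^ (L * S') ≤ (X : ℝ) ^ (X ^ (10 + 3 * k)) := by
    rw [hLS]; gcongr
  have be : Real.exp (W * L * (7 * S')) ≤ (X : ℝ) ^ (X ^ (10 + 3 * k)) := by
    calc Real.exp (W * L * (7 * S')) ≤ Real.exp (((L * S' : ℕ) : ℝ) * Real.log X) := by
          apply Real.exp_le_exp.2
          push_cast
          have : (0 : ℝ) ≤ L * S' := by positivity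
          nlinarith
      _ = (X : ℝ) ^ (X ^ (10 + 3 * k)) := by
          rw [Real.exp_nat_mul, ← hXe, hLS]
  have hsum : 22 + (730 * X ^ 10 + 11 * T + 17 * L0 + X ^ (10 + 3 * k)) ≤
      1000 * X ^ (10 + 3 * k) := by
    omega
  have hfinal : (X : ℝ) ^ 22 * ((X : ℝ) ^ (730 * X ^ 10) * (X : ℝ) ^ (11 * T) *
      (X : ℝ) ^ (17 * L0) * (X : ℝ) ^ (X ^ (10 + 3 * k))) ≤ (X : ℝ) ^ (1000 * X ^ (10 + 3 * k)) := by
    rw [← pow_add, ← pow_add, ← pow_add, ← pow_add]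
    exact pow_le_pow_right₀ hX1 hsum
  have hQ0 : 0 ≤ 3 * H * L0 := by positivity
  refine ⟨?_, ?_, ?_, ?_⟩
  · refine le_trans ?_ hfinal
    gcongr
  · refine le_trans ?_ hfinal
    rw [← mul_assoc P, ← mul_assoc P]
    gcongr
  · refine ba.trans (pow_le_pow_right₀ hX1 ?_)
    omega
  · rw [← pow_mul]
    nth_rewrite 1 [hXe]
    rw [← Real.exp_nat_mul]
    apply Real.exp_lt_exp.2
    have e1 : ((X : ℝ) ^ (10 + 3 * k)) * X ≤ T * S := by
      rw [hT, hS]; push_cast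
      have : (1 : ℝ) ≤ t := by exact_mod_cast ht1
      calc ((X : ℝ) ^ (10 + 3 * k)) * X = 1 * (X : ℝ) ^ 10 * (X : ℝ) ^ (1 + 3 * k) := by ring
        _ ≤ _ := by gcongr
    push_cast
    have e2 : (0 : ℝ) < (X : ℝ) ^ (10 + 3 * k) := by positivity
    have := mul_lt_mul_of_pos_left hh e2
    calc _ = (X : ℝ) ^ (10 + 3 * k) * (1000 * (h + 1) * Real.log X) := by ring
      _ < _ := this
      _ ≤ _ := e1

theorem siegel_num (X : ℕ) (c H A : ℝ) (a0 p : ℕ) (hc1 : 1 ≤ c) (hc : c ≤ X) (hH1 : 1 ≤ H)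
    (hH : 3 * H ≤ X) (ha0 : 1 ≤ a0) (haX : (a0 : ℝ) ≤ X) (hX : 2048 ≤ X)
    (L0 L : ℕ) (hL0 : L0 = 2048 * X ^ 9) (hL : L = X ^ 6) (hp : p = 1024 * X ^ 21)
    (hA : A = (3 * H * L0) ^ (64 * X ^ 10) * (X : ℝ) ^ L0 * (a0 : ℝ) ^ (L * X)) :
    c * (c * (2 * p) * A) ≤ (X : ℝ) ^ (730 * X ^ 10) := by
  have hXR : (2048 : ℝ) ≤ X := by exact_mod_cast hX
  have hX1 : (1 : ℝ) ≤ X := by linarith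
  have hXn : 1 ≤ X := by omega
  have b0 : (L0 : ℝ) ≤ (X : ℝ) ^ 10 := by
    rw [hL0]; push_cast
    calc (2048 * (X : ℝ) ^ 9) ≤ X * (X : ℝ) ^ 9 := by gcongr
      _ = _ := by ring
  have b0n : L0 ≤ X ^ 10 := by exact_mod_cast b0
  have bQ : 3 * H * L0 ≤ (X : ℝ) ^ 11 := by
    calc 3 * H * L0 ≤ X * (X : ℝ) ^ 10 := by gcongr
      _ = _ := by ring
  have hE1 : 1 ≤ X ^ 10 := Nat.one_le_pow _ _ hXn
  have hLX : L * X ≤ X ^ 10 := by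
    rw [hL, ← pow_succ]; exact Nat.pow_le_pow_right hXn (by omega)
  have bp : (2 * p : ℝ) ≤ (X : ℝ) ^ 22 := by
    rw [hp]; push_cast
    calc (2 * (1024 * (X : ℝ) ^ 21)) = 2048 * (X : ℝ) ^ 21 := by ring
      _ ≤ X * (X : ℝ) ^ 21 := by gcongr
      _ = _ := by ring
  have bA : A ≤ (X : ℝ) ^ (706 * X ^ 10) := by
    rw [hA]
    calc _ ≤ ((X : ℝ) ^ 11) ^ (64 * X ^ 10) * (X : ℝ) ^ (X ^ 10) * (X : ℝ) ^ (X ^ 10) := by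
          have q1 : (X : ℝ) ^ L0 ≤ (X : ℝ) ^ (X ^ 10) := pow_le_pow_right₀ hX1 b0n
          have q2 : (a0 : ℝ) ^ (L * X) ≤ (X : ℝ) ^ (X ^ 10) :=
            (pow_le_pow_left₀ (by positivity) haX _).trans (pow_le_pow_right₀ hX1 hLX)
          have hQ0 : 0 ≤ 3 * H * L0 := by positivity
          gcongr
      _ = (X : ℝ) ^ (11 * (64 * X ^ 10) + X ^ 10 + X ^ 10) := by
          rw [pow_add, pow_add, ← pow_mul (X : ℝ) 11]
      _ ≤ _ := pow_le_pow_right₀ hX1 (by omega)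
  have hA0 : 0 ≤ A := by rw [hA]; positivity
  calc c * (c * (2 * p) * A) ≤ X * (X * (X : ℝ) ^ 22 * (X : ℝ) ^ (706 * X ^ 10)) := by
        gcongr
    _ = (X : ℝ) ^ (24 + 706 * X ^ 10) := by rw [pow_add]; ring
    _ ≤ _ := pow_le_pow_right₀ hX1 (by omega)

theorem baker_core {K : Type*} [Field K] [NumberField K] (σ : K →+* ℂ) (d b1 b2 c1 c2 : 𝓞 K)
    (hd : d ≠ 0) (η : ℂ) (ℓ : ℝ) (ω : ℂ) (hℓ0 : ℓ ≠ 0) (hω0 : ω ≠ 0)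
    (hℓ : σ d * ℓ = σ b1 + η * σ c1) (hω : σ d * ω = σ b2 + η * σ c2)
    (num den : ℕ) (hden0 : 0 < den) (heℓ : Complex.exp ℓ = num / den) (heω : Complex.exp ω = 1) :
    False := by
  obtain ⟨c, hc1, hsiegel⟩ := siegel_house K
  set h := Module.finrank ℚ K with hh
  let H : ℝ := 1 + house (d : K) + house (b1 : K) + house (b2 : K) + house (c1 : K) + house (c2 : K)
  have g0 := house_nonneg (d : K)
  have g1 := house_nonneg (b1 : K)
  have g2 := house_nonneg (b2 : K)
  have g3 := house_nonneg (c1 : K)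
  have g4 := house_nonneg (c2 : K)
  have hH1 : 1 ≤ H := by simp only [H]; linarith
  have hHd : house (d : K) ≤ H := by simp only [H]; linarith
  have hHb1 : house (b1 : K) ≤ H := by simp only [H]; linarith
  have hHb2 : house (b2 : K) ≤ H := by simp only [H]; linarith
  have hHc1 : house (c1 : K) ≤ H := by simp only [H]; linarith
  have hHc2 : house (c2 : K) ≤ H := by simp only [H]; linarith
  clear_value H
  let a0 : ℕ := num + den
  have ha0 : 1 ≤ a0 := by omega
  let W : ℝ := ‖(ℓ : ℂ)‖ + ‖ω‖
  have hW0 : 0 ≤ W := by positivity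
  obtain ⟨X, hX1, hX2, hX3⟩ := exists_big (2048 + c + 3 * H + a0 + 7 * W + 1000 * (h + 1))
  have ha0R : (1 : ℝ) ≤ a0 := by exact_mod_cast ha0
  have hhR : (0 : ℝ) ≤ h := by positivity
  have hXR : (2048 : ℝ) ≤ X := by linarith
  have hX : 2048 ≤ X := by exact_mod_cast hXR
  have hlog : 0 ≤ Real.log X := by linarith
  have hcX : c ≤ X := by linarith
  have hHX : 3 * H ≤ X := by linarith
  have haX : (a0 : ℝ) ≤ X := by linarith
  have hWX : 7 * W ≤ Real.log X := by linarith
  have hhX : 1000 * (h + 1) * Real.log X < X := by nlinarith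
  have hXn : 1 ≤ X := by omega
  let L0 : ℕ := 2048 * X ^ 9
  let L : ℕ := X ^ 6
  have hL1 : 1 ≤ L := Nat.one_le_pow _ _ hXn
  have hLL0 : L ≤ L0 := by
    calc X ^ 6 ≤ X ^ 9 := Nat.pow_le_pow_right hXn (by omega)
      _ ≤ _ := by simp only [L0]; omega
  let T0 : ℕ := 32 * X ^ 10
  let A : ℝ := (3 * H * L0) ^ (64 * X ^ 10) * (X : ℝ) ^ L0 * (a0 : ℝ) ^ (L * X)
  have hX1R : (1 : ℝ) ≤ X := by linarith
  have hQ1 : 1 ≤ 3 * H * L0 := by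
    have : (1 : ℝ) ≤ L0 := by exact_mod_cast hL1.trans hLL0
    nlinarith
  have hA1 : 1 ≤ A := by
    have q1 := one_le_pow₀ hQ1 (n := 64 * X ^ 10)
    have q2 := one_le_pow₀ hX1R (n := L0)
    have q3 := one_le_pow₀ ha0R (n := L * X)
    exact one_le_mul_of_one_le_of_one_le (one_le_mul_of_one_le_of_one_le q1 q2) q3
  let mat : Matrix (Fin T0 × Fin T0 × Fin X) (Fin L0 × Fin L × Fin L) (𝓞 K) := fun j i =>
    cA L d b1 b2 c1 c2 num den j.1 j.2.1 j.2.2 i.1 i.2.1 i.2.2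
  have hmat : ∀ j i, house (algebraMap (𝓞 K) K (mat j i)) ≤ A := by
    intro j i
    refine house_le_of_forall _ _ fun τ => ?_
    have e0 : ∀ x : 𝓞 K, τ (x : K) = (τ.comp (algebraMap (𝓞 K) K)) x := fun x => rfl
    have hb : ∀ y : 𝓞 K, house (y : K) ≤ H → ‖(τ.comp (algebraMap (𝓞 K) K)) y‖ ≤ H :=
      fun y hy => (norm_embedding_le_house _ τ).trans hy
    rw [e0, cA_map]
    refine (cA_norm_le L L0 _ _ _ _ _ num den _ _ _ _ _ _ i.2.1.2 i.2.2.2 i.1.2 hLL0 H (hb _ hHd)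
      (hb _ hHb1) (hb _ hHb2) (hb _ hHc1) (hb _ hHc2) a0 ha0 (by omega) (by omega) X hXn
      j.2.2.2.le).trans ?_
    have h1 := j.1.2
    have h2 := j.2.1.2
    simp only [A]
    gcongr
    simp only [T0] at h1 h2
    omega
  have hpp : (0 : ℕ) < 1024 * X ^ 21 := by positivity
  obtain ⟨ξ, hξ0, hξ, hξP⟩ := hsiegel _ _ mat (1024 * X ^ 21) hpp
    (by simp only [Fintype.card_prod, Fintype.card_fin, T0]; ring)
    (by simp only [Fintype.card_prod, Fintype.card_fin, L0, L]; ring) A hA1 hmat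
  have hPnum := siegel_num X c H A a0 (1024 * X ^ 21) hc1 hcX hH1 hHX ha0 haX hX L0 L rfl rfl rfl rfl
  have hP : ∀ i, house (ξ i : K) ≤ (X : ℝ) ^ (730 * X ^ 10) := fun i => (hξP i).trans hPnum
  have hP0 : (0 : ℝ) ≤ (X : ℝ) ^ (730 * X ^ 10) := by positivity
  have start : ∀ m n s : ℕ, m + n < 2 * (16 * X ^ 10) → s < X ^ (1 + 3 * 0) →
      ∑ i : Fin L0 × Fin L × Fin L,
      ξ i * cA L d b1 b2 c1 c2 num den m n s i.1 i.2.1 i.2.2 = 0 := by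
    intro m n s hmn hs
    have hs' : s < X := by simpa using hs
    have := congrFun hξ (⟨m, by simp only [T0]; omega⟩, ⟨n, by simp only [T0]; omega⟩, ⟨s, hs'⟩)
    rw [Matrix.mulVec, dotProduct] at this
    refine Eq.trans (Finset.sum_congr rfl fun i _ => ?_) this
    exact mul_comm _ _
  have step : ∀ k t : ℕ, k ≤ 4 → 1 ≤ t → t ≤ 16 →
      (∀ m n s : ℕ, m + n < 2 * (t * X ^ 10) → s < X ^ (1 + 3 * k) →
      ∑ i : Fin L0 × Fin L × Fin L,
      ξ i * cA L d b1 b2 c1 c2 num den m n s i.1 i.2.1 i.2.2 = 0) →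
      (∀ m n s : ℕ, m + n < t * X ^ 10 → s < X ^ (4 + 3 * k) →
      ∑ i : Fin L0 × Fin L × Fin L,
      ξ i * cA L d b1 b2 c1 c2 num den m n s i.1 i.2.1 i.2.2 = 0) := by
    intro k t hk ht1 ht hz
    obtain ⟨n1, n2, n3, n4⟩ := step_num X h c H W _ a0 hc1 hcX hH1 hHX ha0 haX hX hWX hhX hP0 le_rfl
      k t hk ht1 ht L0 L (t * X ^ 10) (X ^ (1 + 3 * k)) (X ^ (4 + 3 * k)) rfl rfl rfl rfl rfl
    exact baker_step σ d b1 b2 c1 c2 hd η ℓ ω hℓ hω num den hden0 heℓ heω H hH1 hHd hHb1 hHb2 hHc1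
      hHc2 a0 ha0 (by omega) (by omega) W le_rfl L0 L hL1 hLL0 ξ _ hP (t * X ^ 10) (X ^ (1 + 3 * k))
      (X ^ (4 + 3 * k)) (Nat.one_le_pow _ _ hXn) (Nat.pow_le_pow_right hXn (by omega)) hz _
      (one_le_pow₀ hX1R) n1 n2 n3 n4
  have s1 := step 0 16 (by norm_num) (by norm_num) (by norm_num) start
  have s2 := step 1 8 (by norm_num) (by norm_num) (by norm_num)
    (fun m n s hmn hs => s1 m n s (by omega) hs)
  have s3 := step 2 4 (by norm_num) (by norm_num) (by norm_num)
    (fun m n s hmn hs => s2 m n s (by omega) hs)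
  have s4 := step 3 2 (by norm_num) (by norm_num) (by norm_num)
    (fun m n s hmn hs => s3 m n s (by omega) hs)
  have s5 := step 4 1 (by norm_num) (by norm_num) (by norm_num)
    (fun m n s hmn hs => s4 m n s (by omega) hs)
  clear step start s1 s2 s3 s4
  have hdenC : (den : ℂ) ≠ 0 := by exact_mod_cast hden0.ne'
  have hfin := endgame L0 L (X ^ 16) (X ^ 10) (fun k u v => σ (ξ (k, u, v))) (σ d) (σ b1) (σ b2)
    (σ c1) (σ c2) (num / den) (heℓ ▸ Complex.exp_ne_zero _) ?_ ?_ ?_ ?_ ?_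
  · apply hξ0
    funext i
    have := hfin i.1 i.2.1 i.2.2
    simpa using this
  · intro i j hij
    rw [← heℓ, ← Complex.exp_nat_mul, ← Complex.exp_nat_mul] at hij
    have : Real.exp (i * ℓ) = Real.exp (j * ℓ) := by
      have : ((Real.exp (i * ℓ) : ℝ) : ℂ) = ((Real.exp (j * ℓ) : ℝ) : ℂ) := by
        push_cast; exact hij
      exact_mod_cast this
    have := mul_right_cancel₀ hℓ0 (Real.exp_injective this)
    exact_mod_cast this
  · by_contra hcon
    push Not at hcon
    rw [hcon.1, hcon.2] at hω
    have hσd : σ d ≠ 0 := by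
      rw [map_ne_zero]
      simpa using hd
    simp [hσd, hω0] at hω
  · calc L0 * L = 2048 * X ^ 15 := by simp only [L0, L]; ring
      _ ≤ X * X ^ 15 := by gcongr
      _ = X ^ 16 := by ring
  · exact Nat.pow_le_pow_right hXn (by omega)
  · intro m n s hmn hs
    have h1 := s5 m n s (by omega) (by simpa using hs)
    have e0 : ∀ x : 𝓞 K, σ (x : K) = (σ.comp (algebraMap (𝓞 K) K)) x := fun x => rfl
    have h2 := congrArg (σ.comp (algebraMap (𝓞 K) K)) h1
    rw [map_sum, map_zero] at h2
    apply mul_left_cancel₀ (pow_ne_zero (L * s) hdenC)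
    rw [mul_zero, ← h2, Fintype.sum_prod_type, Finset.mul_sum]
    refine Finset.sum_congr rfl fun k _ => ?_
    rw [Fintype.sum_prod_type, Finset.mul_sum]
    refine Finset.sum_congr rfl fun u _ => ?_
    rw [Finset.mul_sum]
    refine Finset.sum_congr rfl fun v _ => ?_
    rw [map_mul, cA_map, cA]
    have e2 : (den : ℂ) ^ (L * s) = (den : ℂ) ^ ((u : ℕ) * s) * (den : ℂ) ^ ((L - u) * s) := by
      rw [← pow_add, ← add_mul, Nat.add_sub_cancel' u.2.le]
    rw [e2, div_pow]
    simp only [← e0]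
    field_simp

theorem baker_main {K : Type*} [Field K] [NumberField K] (σ : K →+* ℂ) (b1 b2 c1 c2 : K)
    (η : ℂ) (ℓ : ℝ) (ω : ℂ) (hℓ0 : ℓ ≠ 0) (hω0 : ω ≠ 0)
    (hℓ : ℓ = σ b1 + η * σ c1) (hω : ω = σ b2 + η * σ c2)
    (num den : ℕ) (hden0 : 0 < den) (heℓ : Complex.exp ℓ = num / den) (heω : Complex.exp ω = 1) :
    False := by
  classical
  obtain ⟨⟨d, hdm⟩, hd⟩ := IsLocalization.exist_integer_multiples_of_finset
    (nonZeroDivisors (𝓞 K)) (S := K) ({b1, b2, c1, c2} : Finset K)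
  have hd0 : d ≠ 0 := nonZeroDivisors.ne_zero hdm
  obtain ⟨b1', h1⟩ := hd b1 (by simp)
  obtain ⟨b2', h2⟩ := hd b2 (by simp)
  obtain ⟨c1', h3⟩ := hd c1 (by simp)
  obtain ⟨c2', h4⟩ := hd c2 (by simp)
  simp only [Algebra.smul_def] at h1 h2 h3 h4
  refine baker_core σ d b1' b2' c1' c2' hd0 η ℓ ω hℓ0 hω0 ?_ ?_ num den hden0 heℓ heω
  · have e1 : σ (b1' : K) = σ d * σ b1 := by rw [← map_mul]; exact congrArg σ h1
    have e3 : σ (c1' : K) = σ d * σ c1 := by rw [← map_mul]; exact congrArg σ h3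
    rw [e1, e3]
    linear_combination (σ d) * hℓ
  · have e2 : σ (b2' : K) = σ d * σ b2 := by rw [← map_mul]; exact congrArg σ h2
    have e4 : σ (c2' : K) = σ d * σ c2 := by rw [← map_mul]; exact congrArg σ h4
    rw [e2, e4]
    linear_combination (σ d) * hω

theorem transcendental_log_add_pi (num den : ℕ) (hnum : 0 < num) (hden : 0 < den) (k : ℤ)
    (hk : k ≠ 0 ∨ num ≠ den) :
    Transcendental ℚ (Real.log ((num : ℝ) / den) + k * Real.pi) := by
  intro halg
  set θ : ℝ := Real.log ((num : ℝ) / den) + k * Real.pi with hθ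
  have halgC : IsAlgebraic ℚ (θ : ℂ) := halg.algebraMap (A := ℂ)
  let F : IntermediateField ℚ ℂ := IntermediateField.adjoin ℚ {(θ : ℂ), Complex.I}
  have hfd : FiniteDimensional ℚ F := by
    apply IntermediateField.finiteDimensional_adjoin
    intro x hx
    rcases hx with rfl | hx
    · exact halgC.isIntegral
    · rw [Set.mem_singleton_iff] at hx
      rw [hx]
      exact Complex.isIntegral_rat_I
  have hNF : NumberField F := { to_charZero := inferInstance, to_finiteDimensional := hfd }
  have hmθ : (θ : ℂ) ∈ F := IntermediateField.subset_adjoin _ _ (by simp)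
  have hmI : Complex.I ∈ F := IntermediateField.subset_adjoin _ _ (by simp)
  let σ : F →+* ℂ := algebraMap F ℂ
  let tθ : F := ⟨θ, hmθ⟩
  let tI : F := ⟨Complex.I, hmI⟩
  have hσθ : σ tθ = θ := rfl
  have hσI : σ tI = Complex.I := rfl
  have hpi : (Real.pi : ℂ) ≠ 0 := by exact_mod_cast Real.pi_ne_zero
  have hω0 : (2 * Real.pi * Complex.I : ℂ) ≠ 0 := Complex.two_pi_I_ne_zero
  have heω : Complex.exp (2 * Real.pi * Complex.I) = 1 := Complex.exp_two_pi_mul_I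
  have hexp : ∀ a b : ℕ, 0 < a → 0 < b →
      Complex.exp ((Real.log ((a : ℝ) / b) : ℝ) : ℂ) = a / b := by
    intro a b ha hb
    have : (0 : ℝ) < (a : ℝ) / b := by positivity
    rw [← Complex.ofReal_exp, Real.exp_log this]
    push_cast
    rfl
  have hlog0 : ∀ a b : ℕ, 0 < a → 0 < b → a ≠ b → Real.log ((a : ℝ) / b) ≠ 0 := by
    intro a b ha hb hab
    have hp : (0 : ℝ) < (a : ℝ) / b := by positivity
    apply Real.log_ne_zero_of_pos_of_ne_one hp
    have hb' : (b : ℝ) ≠ 0 := by positivity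
    rw [Ne, div_eq_one_iff_eq hb']
    exact_mod_cast hab
  have hθC : (θ : ℂ) = ((Real.log ((num : ℝ) / den) : ℝ) : ℂ) + k * Real.pi := by
    rw [hθ]; push_cast; rfl
  by_cases hk0 : k = 0
  · have hne : num ≠ den := by
      rcases hk with h | h
      · exact absurd hk0 h
      · exact h
    refine baker_main σ tθ 0 0 1 (2 * Real.pi * Complex.I) (Real.log ((num : ℝ) / den))
      (2 * Real.pi * Complex.I) (hlog0 _ _ hnum hden hne) hω0 ?_ ?_ num den hden
      (hexp _ _ hnum hden) heω
    · rw [hσθ, hθC, hk0]; simp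
    · simp
  · have hkC : (k : ℂ) ≠ 0 := by exact_mod_cast hk0
    by_cases hne : num = den
    · have hlz : Real.log ((num : ℝ) / den) = 0 := by
        rw [hne, div_self (by positivity), Real.log_one]
      refine baker_main σ 0 (2 * tI * tθ / k) 1 0 (Real.log (((2 : ℕ) : ℝ) / (1 : ℕ)) : ℝ)
        (Real.log (((2 : ℕ) : ℝ) / (1 : ℕ)))
        (2 * Real.pi * Complex.I) (hlog0 2 1 (by norm_num) (by norm_num) (by norm_num)) hω0 ?_ ?_ 2 1
        (by norm_num) (hexp 2 1 (by norm_num) (by norm_num)) heω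
      · simp
      · rw [map_div₀, map_mul, map_mul, hσθ, hσI, hθC, hlz]
        simp
        field_simp
        exact (map_ofNat σ 2).symm
    · refine baker_main σ 0 (2 * tI * tθ / k) 1 (- (2 * tI / k)) (Real.log ((num : ℝ) / den) : ℝ)
        (Real.log ((num : ℝ) / den))
        (2 * Real.pi * Complex.I) (hlog0 _ _ hnum hden hne) hω0 ?_ ?_ num den
        hden (hexp _ _ hnum hden) heω
      · rw [map_zero, map_one, mul_one, zero_add]
      · rw [map_div₀, map_mul, map_mul, hσθ, map_neg, map_div₀, map_mul, hσI, hθC, map_intCast,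
          map_ofNat]
        field_simp
        ring

end BakerParts

/-- **Key step of Theorem 1.** For non-isomorphic quadratic number fields `K` and `L`
(equivalently, `d_K ≠ d_L`), the real number
`log|d_K| − log|d_L| + (π/2)(r₁(L) − r₁(K))` is transcendental; in particular nonzero. -/
theorem transcendental_log_discr_quotient_quadratic
    (K L : Type*) [Field K] [NumberField K] [Field L] [NumberField L]
    (hK : Module.finrank ℚ K = 2) (hL : Module.finrank ℚ L = 2)
    (hKL : NumberField.discr K ≠ NumberField.discr L) :
    Transcendental ℚ (Real.log |(NumberField.discr K : ℝ)| -
        Real.log |(NumberField.discr L : ℝ)| +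
      Real.pi / 2 * ((NumberField.InfinitePlace.nrRealPlaces L : ℝ) -
        (NumberField.InfinitePlace.nrRealPlaces K : ℝ))) ∧
    Real.log |(NumberField.discr K : ℝ)| - Real.log |(NumberField.discr L : ℝ)| +
      Real.pi / 2 * ((NumberField.InfinitePlace.nrRealPlaces L : ℝ) -
        (NumberField.InfinitePlace.nrRealPlaces K : ℝ)) ≠ 0 := by
  have main : Transcendental ℚ (Real.log |(NumberField.discr K : ℝ)| -
        Real.log |(NumberField.discr L : ℝ)| +
      Real.pi / 2 * ((NumberField.InfinitePlace.nrRealPlaces L : ℝ) -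
        (NumberField.InfinitePlace.nrRealPlaces K : ℝ))) := by
    have hdK := NumberField.discr_ne_zero K
    have hdL := NumberField.discr_ne_zero L
    have hsK := NumberField.sign_discr K
    have hsL := NumberField.sign_discr L
    have hcK := NumberField.InfinitePlace.card_add_two_mul_card_eq_rank K
    have hcL := NumberField.InfinitePlace.card_add_two_mul_card_eq_rank L
    rw [hK] at hcK
    rw [hL] at hcL
    have eK : (NumberField.InfinitePlace.nrRealPlaces K : ℝ) =
        2 - 2 * (NumberField.InfinitePlace.nrComplexPlaces K : ℝ) := by
      have : ((NumberField.InfinitePlace.nrRealPlaces K +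
        2 * NumberField.InfinitePlace.nrComplexPlaces K : ℕ) : ℝ) = (2 : ℕ) := by rw [hcK]
      push_cast at this
      linarith
    have eL : (NumberField.InfinitePlace.nrRealPlaces L : ℝ) =
        2 - 2 * (NumberField.InfinitePlace.nrComplexPlaces L : ℝ) := by
      have : ((NumberField.InfinitePlace.nrRealPlaces L +
        2 * NumberField.InfinitePlace.nrComplexPlaces L : ℕ) : ℝ) = (2 : ℕ) := by rw [hcL]
      push_cast at this
      linarith
    have key := transcendental_log_add_pi (NumberField.discr K).natAbs (NumberField.discr L).natAbs
      (Int.natAbs_pos.2 hdK) (Int.natAbs_pos.2 hdL)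
      ((NumberField.InfinitePlace.nrComplexPlaces K : ℤ) -
        (NumberField.InfinitePlace.nrComplexPlaces L : ℤ)) ?_
    · convert key using 1
      rw [Real.log_div (by simpa using hdK) (by simpa using hdL), Nat.cast_natAbs, Nat.cast_natAbs,
        eK, eL]
      push_cast
      ring
    · by_contra hcon
      push Not at hcon
      obtain ⟨h1, h2⟩ := hcon
      have h3 : NumberField.InfinitePlace.nrComplexPlaces K =
        NumberField.InfinitePlace.nrComplexPlaces L := by omega
      apply hKL
      rw [← Int.sign_mul_natAbs (NumberField.discr K), ← Int.sign_mul_natAbs (NumberField.discr L),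
        hsK, hsL, h3, h2]
  refine ⟨main, fun h => ?_⟩
  rw [h] at main
  exact main isAlgebraic_zero
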